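/- No semantics is both order-based and filter-based: there is no semantics S such that S = S_⪯ for some suitable order ⪯ and simultaneously S is defined by some filter f_S with S(D,R) = {w ∈ matches(D,R) : f_S(w)=⊤}. -/

import Mathlib

namespace RPQ

/-- Vertex identifiers. -/
abbrev V : Type := ℕ
/-- Edge identifiers. -/
abbrev Edg : Type := ℕ
/-- Labels. -/
abbrev Lab : Type := ℕ

/-- A walk: a nonempty alternating sequence `v₀,e₁,v₁,…,e_k,v_k`, encoded as the
initial vertex together with the list of (edge, next-vertex) pairs. -/
structure Walk where
  head : V
  steps : List (Edg × V)
deriving DecidableEq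

namespace Walk

def length (w : Walk) : ℕ := w.steps.length
def src (w : Walk) : V := w.head
def tgt (w : Walk) : V := (w.steps.map Prod.snd).getLastD w.head
/-- The pair of endpoints of a walk. -/
def ep (w : Walk) : V × V := (w.src, w.tgt)
def vertexList (w : Walk) : List V := w.head :: w.steps.map Prod.snd
def edgeList (w : Walk) : List Edg := w.steps.map Prod.fst
/-- Concatenation of walks (meaningful when `w.tgt = w'.src`). -/
def concat (w w' : Walk) : Walk := ⟨w.head, w.steps ++ w'.steps⟩

end Walk

/-- A graph database. -/
structure Database where
  labels : Finset Lab
  verts : Finset V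
  edges : Finset Edg
  src : Edg → V
  tgt : Edg → V
  lbl : Edg → Lab
  src_mem : ∀ e ∈ edges, src e ∈ verts
  tgt_mem : ∀ e ∈ edges, tgt e ∈ verts
  lbl_mem : ∀ e ∈ edges, lbl e ∈ labels

def chainFrom (D : Database) : V → List (Edg × V) → Prop
  | _, [] => True
  | v, (e, v') :: rest =>
      e ∈ D.edges ∧ D.src e = v ∧ D.tgt e = v' ∧ chainFrom D v' rest

/-- `w` is consistent with `D`, i.e. `w` is a walk in `D`. -/
def Walk.Consistent (D : Database) (w : Walk) : Prop :=
  w.head ∈ D.verts ∧ chainFrom D w.head w.steps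

/-- The set of walks in `D`. -/
def Walks (D : Database) : Set Walk := {w | w.Consistent D}

/-- The label of a walk in `D`: the word of its successive edge labels. -/
def Walk.label (D : Database) (w : Walk) : List Lab :=
  w.steps.map fun p => D.lbl p.1

abbrev RE := RegularExpression Lab

/-- Matches of `R` in `D`: walks in `D` whose label conforms to `R`. -/
def Matches (D : Database) (R : RE) : Set Walk :=
  {w | w.Consistent D ∧ w.label D ∈ R.matches'}

/-- A semantics maps a database and a query to a finite subset of its matches. -/
def IsSemantics (S : Database → RE → Set Walk) : Prop :=
  ∀ D R, S D R ⊆ Matches D R ∧ (S D R).Finite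

/-- `S` is walk-based. -/
def WalkBased (S : Database → RE → Set Walk) : Prop :=
  ∃ r : Set Walk → Set Walk, ∀ D R, S D R = r (Matches D R)

/-- The semantics defined by a filter `f`. -/
def FilterSem (f : Walk → Bool) (D : Database) (R : RE) : Set Walk :=
  {w ∈ Matches D R | f w = true}

/-- Componentwise inclusion of databases. -/
def Database.Sub (D D' : Database) : Prop :=
  D.labels ⊆ D'.labels ∧ D.verts ⊆ D'.verts ∧ D.edges ⊆ D'.edges ∧
    ∀ e ∈ D.edges, D'.src e = D.src e ∧ D'.tgt e = D.tgt e ∧ D'.lbl e = D.lbl e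

def IsPartialOrderRel (le : Walk → Walk → Prop) : Prop :=
  (∀ w, le w w) ∧ (∀ a b c, le a b → le b c → le a c) ∧ ∀ a b, le a b → le b a → a = b

/-- `le` is a well-partial-order on the walks of `D`. -/
def IsWpoOn (le : Walk → Walk → Prop) (D : Database) : Prop :=
  ∀ f : ℕ → Walk, (∀ n, (f n).Consistent D) → ∃ i j, i < j ∧ le (f i) (f j)

/-- Suitable order: a partial order on walks that is a wpo on `Walks D` for each `D`. -/
def Suitable (le : Walk → Walk → Prop) : Prop :=
  IsPartialOrderRel le ∧ ∀ D, IsWpoOn le D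

/-- The semantics based on the order `le`: the `le`-minimal matches among those
with the same endpoints. -/
def OrderSem (le : Walk → Walk → Prop) (D : Database) (R : RE) : Set Walk :=
  {w ∈ Matches D R | ∀ w' ∈ Matches D R, w'.ep = w.ep → le w' w → w' = w}

def Monotonous (S : Database → RE → Set Walk) : Prop :=
  ∀ D D' R, D.Sub D' → S D R ⊆ S D' R

def CoMonotonous (S : Database → RE → Set Walk) : Prop :=
  ∀ D D' R, D.Sub D' → S D' R ∩ Walks D ⊆ S D R

def Stabilizing (S : Database → RE → Set Walk) : Prop :=
  ∀ (D : Database) (Rs : ℕ → RE),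
    (∀ i j, i ≤ j → ∀ u, u ∈ (Rs i).matches' → u ∈ (Rs j).matches') →
    ∃ N, ∀ n, N ≤ n → S D (Rs n) = S D (Rs N)

/-- Concatenation lifted to sets of walks. -/
def setConcat (W W' : Set Walk) : Set Walk :=
  {u | ∃ w ∈ W, ∃ w' ∈ W', w.tgt = w'.src ∧ u = w.concat w'}

/-- `setStar W` : all concatenations `w₁·…·w_k` (k ≥ 1) of walks of `W`. -/
inductive setStar (W : Set Walk) : Walk → Prop
  | base : ∀ w ∈ W, setStar W w
  | step : ∀ u w, setStar W u → w ∈ W → u.tgt = w.src → setStar W (u.concat w)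

/-- Walks jointly consistent with some database. -/
def ConsistentPair (w w' : Walk) : Prop :=
  ∃ D : Database, w.Consistent D ∧ w'.Consistent D

/-- The trimming of an order. -/
def trimRel (le : Walk → Walk → Prop) (w w' : Walk) : Prop :=
  ConsistentPair w w' ∧ w.ep = w'.ep ∧ le w w'

def Trimmed (le : Walk → Walk → Prop) : Prop := trimRel le = le

/-- `le` respects element inclusion. -/
def RespectsElemIncl (le : Walk → Walk → Prop) : Prop :=
  ∀ w w', le w w' →
    (∀ v ∈ w.vertexList, v ∈ w'.vertexList) ∧ ∀ e ∈ w.edgeList, e ∈ w'.edgeList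

/-- Action of a relabeling on a database. -/
def Database.relabel (π : Equiv.Perm Lab) (D : Database) : Database where
  labels := D.labels.image (⇑π)
  verts := D.verts
  edges := D.edges
  src := D.src
  tgt := D.tgt
  lbl := fun e => π (D.lbl e)
  src_mem := D.src_mem
  tgt_mem := D.tgt_mem
  lbl_mem := fun e he => Finset.mem_image_of_mem (⇑π) (D.lbl_mem e he)

/-- Action of a renaming on a walk. -/
def Walk.rename (νv : Equiv.Perm V) (νe : Equiv.Perm Edg) (w : Walk) : Walk :=
  ⟨νv w.head, w.steps.map fun p => (νe p.1, νv p.2)⟩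

/-- Action of a renaming on a database. -/
def Database.rename (νv : Equiv.Perm V) (νe : Equiv.Perm Edg) (D : Database) :
    Database where
  labels := D.labels
  verts := D.verts.image (⇑νv)
  edges := D.edges.image (⇑νe)
  src := fun e => νv (D.src (νe.symm e))
  tgt := fun e => νv (D.tgt (νe.symm e))
  lbl := fun e => D.lbl (νe.symm e)
  src_mem := by
    intro e he
    obtain ⟨e', he', rfl⟩ := Finset.mem_image.mp he
    simpa using Finset.mem_image_of_mem (⇑νv) (D.src_mem e' he')
  tgt_mem := by
    intro e he
    obtain ⟨e', he', rfl⟩ := Finset.mem_image.mp he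
    simpa using Finset.mem_image_of_mem (⇑νv) (D.tgt_mem e' he')
  lbl_mem := by
    intro e he
    obtain ⟨e', he', rfl⟩ := Finset.mem_image.mp he
    simpa using D.lbl_mem e' he'

/-- Identifier independence. -/
def IdIndependent (S : Database → RE → Set Walk) : Prop :=
  ∀ (νv : Equiv.Perm V) (νe : Equiv.Perm Edg) (D : Database) (R : RE),
    Walk.rename νv νe '' S D R = S (Database.rename νv νe D) R

/-- Unbounded semantics. -/
def Unbounded (S : Database → RE → Set Walk) : Prop :=
  ∀ n : ℕ, ∃ (D : Database) (R : RE) (w : Walk), w ∈ S D R ∧ n ≤ w.length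

/-- Shortest-walk semantics. -/
def Sh (D : Database) (R : RE) : Set Walk :=
  {w ∈ Matches D R | ∀ w' ∈ Matches D R, w'.ep = w.ep → w.length ≤ w'.length}

/-- The factor-inserting relation `F`. -/
def FactorIns (w w' : Walk) : Prop :=
  ∃ w₁ w₂ w₃ : Walk, w₁.tgt = w₂.src ∧ w₂.tgt = w₃.src ∧ w₁.tgt = w₃.src ∧
    w = w₁.concat w₃ ∧ w' = (w₁.concat w₂).concat w₃

/-- The subwalk order: reflexive–transitive closure of `FactorIns`. -/
def SubwalkOrd : Walk → Walk → Prop := Relation.ReflTransGen FactorIns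

/-- The database with one vertex and one loop edge. -/
def loopDatabase : Database where
  labels := {0}
  verts := {0}
  edges := {0}
  src := fun _ => 0
  tgt := fun _ => 0
  lbl := fun _ => 0
  src_mem := by simp
  tgt_mem := by simp
  lbl_mem := by simp

/-- The walk following the loop `n` times. -/
def loopWalk (n : ℕ) : Walk := ⟨0, List.replicate n (0, 0)⟩

lemma loopWalk_injective : Function.Injective loopWalk := fun m n h => by
  simpa [loopWalk, Walk.length] using congrArg Walk.length h

lemma loopWalk_consistent (n : ℕ) : (loopWalk n).Consistent loopDatabase := by
  refine ⟨by simp [loopWalk, loopDatabase], ?_⟩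
  induction n with
  | zero => trivial
  | succ n ih => exact ⟨by simp [loopDatabase], rfl, rfl, ih⟩

lemma loopWalk_label (n : ℕ) :
    (loopWalk n).label loopDatabase = List.replicate n 0 := by
  simp [Walk.label, loopWalk, loopDatabase]

lemma eq_loopWalk_of_consistent {w : Walk} (hw : w.Consistent loopDatabase) :
    w = loopWalk w.length := by
  obtain ⟨v, l⟩ := w
  obtain ⟨hv, hl⟩ := hw
  obtain rfl : v = 0 := by simpa [loopDatabase] using hv
  suffices l = List.replicate l.length (0, 0) from congrArg (Walk.mk 0) this
  clear hv
  induction l with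
  | nil => rfl
  | cons p l ih =>
    obtain ⟨e, v⟩ := p
    obtain ⟨he, -, hv, hl⟩ := hl
    obtain rfl : e = 0 := by simpa [loopDatabase] using he
    obtain rfl : v = 0 := hv.symm
    rw [List.length_cons, List.replicate_succ, ← ih hl]

lemma mem_matches'_char_pow {α : Type*} (a : α) (n : ℕ) (u : List α) :
    u ∈ ((RegularExpression.char a) ^ n).matches' ↔ u = List.replicate n a := by
  rw [RegularExpression.matches'_pow, RegularExpression.matches'_char]
  induction n generalizing u with
  | zero => simp [Language.mem_one]
  | succ n ih =>
    rw [pow_succ', Language.mem_mul]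
    constructor
    · rintro ⟨x, hx, y, hy, rfl⟩
      rw [Set.mem_singleton_iff.mp hx, (ih y).mp hy]
      rfl
    · rintro rfl
      exact ⟨[a], rfl, _, (ih _).mpr rfl, rfl⟩

lemma matches_loopDatabase_char_pow (n : ℕ) :
    Matches loopDatabase (RegularExpression.char 0 ^ n) = {loopWalk n} := by
  ext w
  constructor
  · rintro ⟨hc, hl⟩
    have h := congrArg List.length ((mem_matches'_char_pow 0 n _).mp hl)
    rw [Walk.label, List.length_map, List.length_replicate] at h
    rw [Set.mem_singleton_iff, eq_loopWalk_of_consistent hc, Walk.length, h]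
  · rintro rfl
    exact ⟨loopWalk_consistent n, (mem_matches'_char_pow 0 n _).mpr (loopWalk_label n)⟩

lemma loopWalk_mem_matches_star (n : ℕ) :
    loopWalk n ∈ Matches loopDatabase (RegularExpression.char 0).star := by
  refine ⟨loopWalk_consistent n, ?_⟩
  rw [RegularExpression.matches'_star, Language.kstar_eq_iSup_pow, Language.mem_iSup]
  refine ⟨n, ?_⟩
  rw [← RegularExpression.matches'_pow, mem_matches'_char_pow, loopWalk_label]

/-- No semantics is both order-based and filter-based. -/
theorem no_orderBased_and_filterBased :
    ¬ ∃ S : Database → RE → Set Walk, IsSemantics S ∧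
        (∃ le : Walk → Walk → Prop, Suitable le ∧ ∀ D R, S D R = OrderSem le D R) ∧
        ∃ f : Walk → Bool, ∀ D R, S D R = FilterSem f D R := by
  rintro ⟨S, hS, ⟨le, -, hle⟩, f, hf⟩
  have hpass : ∀ n, f (loopWalk n) = true := fun n => by
    have hmem : loopWalk n ∈ S loopDatabase (RegularExpression.char 0 ^ n) := by
      rw [hle, OrderSem, matches_loopDatabase_char_pow]
      exact ⟨rfl, fun w hw _ _ => hw⟩
    rw [hf] at hmem
    exact hmem.2
  refine Set.infinite_of_injective_forall_mem loopWalk_injective (fun n => ?_)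
    (hS loopDatabase (RegularExpression.char 0).star).2
  rw [hf]
  exact ⟨loopWalk_mem_matches_star n, hpass n⟩

end RPQ
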